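/- arXiv:1810.04166 — 2 statements merged into one kernel-verified Lean document; each statement's English description precedes it below -/
import Mathlib

section
/- Let G be a finite group, H a normal subgroup of prime index p, η an irreducible complex representation of H, and e_η = (deg η/|H|) Σ_{h∈H} χ_η(h⁻¹) h its primitive central idempotent in ℂ[H] ⊆ ℂ[G]. If e_η is central in ℂ[G], then there exist exactly p pairwise inequivalent irreducible complex representations ρ_0, ρ_1, …, ρ_{p−1} of G whose restriction to H is equivalent to η, and e_η = e_{ρ_0} + e_{ρ_1} + ⋯ + e_{ρ_{p−1}}, where e_{ρ_i} = (deg ρ_i/|G|) Σ_{g∈G} χ_{ρ_i}(g⁻¹) g is the primitive central idempotent of ℂ[G] corresponding to ρ_i. -/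
/-- A representation is irreducible if the space is nonzero and has no proper nonzero
invariant subspace. -/
def IsIrreducibleRep {k G V : Type*} [CommSemiring k] [Monoid G] [AddCommMonoid V]
    [Module k V] (ρ : Representation k G V) : Prop :=
  Nontrivial V ∧
    ∀ W : Submodule k V, (∀ (g : G) (v : V), v ∈ W → ρ g v ∈ W) → W = ⊥ ∨ W = ⊤

/-- Equivalence (isomorphism) of representations. -/
def RepEquiv {k G V W : Type*} [CommSemiring k] [Monoid G] [AddCommMonoid V] [Module k V]
    [AddCommMonoid W] [Module k W]
    (ρ : Representation k G V) (σ : Representation k G W) : Prop :=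
  ∃ e : V ≃ₗ[k] W, ∀ (g : G) (v : V), e (ρ g v) = σ g (e v)

/-- The primitive central idempotent `e_η = (deg η / |K|) ∑_{k ∈ K} χ_η(k⁻¹) k` attached to
a complex representation `η` of a finite group `K`, written as an element of `ℂ[G]` via an
embedding `φ : K →* G` (e.g. `K` a subgroup of `G` and `φ` the inclusion, or `φ = id`). -/
noncomputable def pciMap {K G : Type*} [Group K] [Group G] [Finite K] {W : Type*}
    [AddCommGroup W] [Module ℂ W] (φ : K →* G) (η : Representation ℂ K W) :
    MonoidAlgebra ℂ G :=
  haveI := Fintype.ofFinite K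
  ∑ k : K, ((Module.finrank ℂ W : ℂ) / (Nat.card K : ℂ) * LinearMap.trace ℂ W (η k⁻¹)) •
      MonoidAlgebra.of ℂ G (φ k)

open Module in
/-- **Schur's lemma** for `IsIrreducibleRep` over `ℂ`. -/
theorem IsIrreducibleRep.exists_eq_smul_one {K W : Type*} [Group K] [AddCommGroup W] [Module ℂ W]
    [FiniteDimensional ℂ W] {η : Representation ℂ K W} (hη : IsIrreducibleRep η)
    (A : End ℂ W) (hA : ∀ h, A * η h = η h * A) : ∃ c : ℂ, A = c • 1 := by
  have := hη.1
  obtain ⟨c, hc⟩ := End.exists_eigenvalue A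
  refine ⟨c, ?_⟩
  have htop := (hη.2 (End.eigenspace A c) fun g v hv => by
    rw [End.mem_eigenspace_iff] at hv ⊢
    rw [← End.mul_apply, hA, End.mul_apply, hv, map_smul]).resolve_left hc
  ext v
  have hv : v ∈ End.eigenspace A c := htop ▸ Submodule.mem_top
  simpa using End.mem_eigenspace_iff.1 hv

theorem IsIrreducibleRep.isIrreducible {K W : Type*} [Group K] [AddCommGroup W] [Module ℂ W]
    {η : Representation ℂ K W} (hη : IsIrreducibleRep η) : η.IsIrreducible := by
  have := hη.1
  have : Nontrivial (Subrepresentation η) := by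
    refine ⟨⊥, ⊤, fun h => ?_⟩
    have := congrArg Subrepresentation.toSubmodule h
    exact bot_ne_top (α := Submodule ℂ W) this
  refine ⟨fun U => ?_⟩
  refine (hη.2 U.toSubmodule fun g v hv => U.apply_mem_toSubmodule g hv).imp ?_ ?_ <;>
    exact fun h => Subrepresentation.toSubmodule_injective h

/-- Irreducible complex representations of a finite group with the same character are
equivalent. -/
theorem IsIrreducibleRep.repEquiv_of_trace_eq {K V W : Type*} [Group K] [Finite K]
    [AddCommGroup V] [Module ℂ V] [FiniteDimensional ℂ V]
    [AddCommGroup W] [Module ℂ W] [FiniteDimensional ℂ W]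
    {σ : Representation ℂ K V} {η : Representation ℂ K W}
    (hσ : IsIrreducibleRep σ) (hη : IsIrreducibleRep η)
    (h : ∀ k, LinearMap.trace ℂ V (σ k) = LinearMap.trace ℂ W (η k)) : RepEquiv σ η := by
  have := Fintype.ofFinite K
  have := hσ.isIrreducible
  have := hη.isIrreducible
  have : Invertible (Nat.card K : ℂ) := invertibleOfNonzero (Nat.cast_ne_zero.2 Nat.card_pos.ne')
  have hchar : σ.character = η.character := funext h
  have h₁ := η.char_orthonormal η
  have h₂ := η.char_orthonormal σ
  rw [if_pos ⟨Representation.Equiv.refl η⟩] at h₁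
  rw [hchar, h₁] at h₂
  obtain ⟨e⟩ : Nonempty (σ.Equiv η) := by
    by_contra hne
    simp [hne] at h₂
  exact ⟨e.toLinearEquiv, fun g v => e.toIntertwiningMap.isIntertwining _ _ g v⟩

/-- If `∑ k, a k • φ k` is central in `ℂ[G]`, with `φ` the inclusion of a normal subgroup, then
`a` is invariant under conjugation by `G`. -/
theorem coeff_conjNormal_of_sum_mem_center {G : Type*} [Group G] (H : Subgroup G) [H.Normal]
    [Fintype H] (a : H → ℂ)
    (hc : ∑ k : H, a k • MonoidAlgebra.of ℂ G (H.subtype k) ∈ Set.center (MonoidAlgebra ℂ G))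
    (t : G) (h : H) : a (MulAut.conjNormal t h) = a h := by
  have hcomm := (hc.comm (MonoidAlgebra.of ℂ G t)).eq
  simp only [Finset.sum_mul, Finset.mul_sum, smul_mul_assoc, mul_smul_comm, ← map_mul] at hcomm
  have hcoeff := congrArg (fun x : MonoidAlgebra ℂ G => x.coeff (t * h)) hcomm
  have hleft (c : H) : (c : G) * t = t * h ↔ c = MulAut.conjNormal t h := by
    rw [Subtype.ext_iff, MulAut.conjNormal_apply, eq_mul_inv_iff_mul_eq]
  classical
  simpa [MonoidAlgebra.coeff_sum, Finsupp.single_apply, hleft] using hcoeff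

theorem map_conjNormal_zpow {G X : Type*} [Group G] [Group X] (H : Subgroup G) [H.Normal]
    (φ : H →* X) (t : G) (T : X) (hT : ∀ h, T * φ h * T⁻¹ = φ (MulAut.conjNormal t h)) (n : ℤ) :
    ∀ h, T ^ n * φ h = φ (MulAut.conjNormal (t ^ n) h) * T ^ n := by
  have hT' (h) : T⁻¹ * φ h * T = φ ((MulAut.conjNormal t)⁻¹ h) := by
    have := hT ((MulAut.conjNormal t)⁻¹ h)
    rw [MulAut.apply_inv_self] at this
    rw [← this]
    group
  induction n with
  | zero => simp
  | succ n ih =>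
    intro h
    rw [zpow_add_one, mul_assoc, ← inv_mul_cancel_right (T * φ h) T, hT, ← mul_assoc, ih,
      zpow_add_one, map_mul, MulAut.mul_apply, mul_assoc]
  | pred n ih =>
    intro h
    rw [zpow_sub_one, mul_assoc, ← mul_inv_cancel_right (T⁻¹ * φ h) T, hT', ← mul_assoc, ih,
      zpow_sub_one, map_mul, MulAut.mul_apply, mul_assoc, map_inv]

/-- A homomorphism on a normal subgroup `H` extends to `G`
when `G` is generated by `H` and `t`, given a compatible image `T` of `t`. -/
theorem exists_monoidHom_extension {G X : Type*} [Group G] [Group X] (H : Subgroup G) [H.Normal]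
    (φ : H →* X) (t : G) (T : X) (hT : ∀ h, T * φ h * T⁻¹ = φ (MulAut.conjNormal t h))
    (p : ℕ) (htp : t ^ p ∈ H) (hTp : T ^ p = φ ⟨t ^ p, htp⟩)
    (hdvd : ∀ n : ℤ, t ^ n ∈ H → (p : ℤ) ∣ n) (hgen : ∀ g : G, ∃ n : ℤ, ∃ h : H, g = t ^ n * h) :
    ∃ ψ : G →* X, ∀ h : H, ψ h = φ h := by
  have hpow := map_conjNormal_zpow H φ t T hT
  have hTn (n : ℤ) (hn : t ^ n ∈ H) : T ^ n = φ ⟨t ^ n, hn⟩ := by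
    obtain ⟨k, rfl⟩ := hdvd n hn
    rw [zpow_mul, zpow_natCast, hTp, ← map_zpow]
    congr 1
    ext
    simp [zpow_mul]
  have huniq (n m : ℤ) (h k : H) (hnm : t ^ n * h = t ^ m * k) :
      T ^ n * φ h = T ^ m * φ k := by
    have h₁ : t ^ (n - m) = ((k * h⁻¹ : H) : G) := by
      rw [Subgroup.coe_mul, Subgroup.coe_inv, eq_mul_inv_iff_mul_eq, sub_eq_neg_add, zpow_add,
        mul_assoc, hnm, zpow_neg, inv_mul_cancel_left]
    have h₂ : T ^ (n - m) = φ (k * h⁻¹) := by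
      rw [hTn (n - m) (h₁ ▸ SetLike.coe_mem _)]
      exact congrArg φ (Subtype.ext h₁)
    rw [← add_sub_cancel m n, zpow_add, h₂, map_mul, map_inv, mul_assoc, inv_mul_cancel_right]
  choose n k hnk using hgen
  refine ⟨MonoidHom.mk' (fun g => T ^ n g * φ (k g)) fun a b => ?_, fun h => ?_⟩
  · have h₁ := hpow (n b) (MulAut.conjNormal (t ^ (-n b)) (k a))
    rw [← MulAut.mul_apply, ← map_mul, ← zpow_add, add_neg_cancel, zpow_zero, map_one,
      MulAut.one_apply] at h₁
    rw [huniq (n (a * b)) (n a + n b) (k (a * b)) (MulAut.conjNormal (t ^ (-n b)) (k a) * k b),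
      zpow_add, map_mul, mul_assoc, mul_assoc, ← mul_assoc (φ (k a)), ← h₁, mul_assoc]
    rw [← hnk]
    nth_rw 1 [hnk a, hnk b]
    simp only [Subgroup.coe_mul, MulAut.conjNormal_apply]
    group
  · simpa using huniq (n h) 0 (k h) h (by rw [← hnk]; simp)

/-- Invertible scalars as automorphisms of a complex vector space. -/
noncomputable def scalarUnits (W : Type*) [AddCommGroup W] [Module ℂ W] :
    ℂˣ →* (Module.End ℂ W)ˣ :=
  Units.map (algebraMap ℂ (Module.End ℂ W))

theorem scalarUnits_commute {W : Type*} [AddCommGroup W] [Module ℂ W] (c : ℂˣ)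
    (A : (Module.End ℂ W)ˣ) : Commute (scalarUnits W c) A :=
  Units.ext (Algebra.commutes (c : ℂ) (A : Module.End ℂ W))

theorem scalarUnits_injective (W : Type*) [AddCommGroup W] [Module ℂ W] [Nontrivial W] :
    Function.Injective (scalarUnits W) :=
  Units.map_injective (FaithfulSMul.algebraMap_injective ℂ (Module.End ℂ W))

theorem IsIrreducibleRep.exists_eq_scalarUnits {K W : Type*} [Group K] [AddCommGroup W]
    [Module ℂ W] [FiniteDimensional ℂ W] {η : Representation ℂ K W} (hη : IsIrreducibleRep η)
    (A : (Module.End ℂ W)ˣ)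
    (hA : ∀ h, A * MonoidHom.toHomUnits η h = MonoidHom.toHomUnits η h * A) :
    ∃ c : ℂˣ, A = scalarUnits W c := by
  obtain ⟨c, hc⟩ := hη.exists_eq_smul_one A fun h => congrArg Units.val (hA h)
  have := hη.1
  have hc0 : c ≠ 0 := by
    rintro rfl
    simp at hc
  refine ⟨Units.mk0 c hc0, Units.ext ?_⟩
  rw [hc, scalarUnits, Units.coe_map, Units.val_mk0]
  exact (Algebra.algebraMap_eq_smul_one c).symm

/-- An irreducible representation of a normal subgroup of prime index whose character is
`G`-invariant extends to `G`. -/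
theorem IsIrreducibleRep.exists_extension {G W : Type*} [Group G] [Finite G]
    (H : Subgroup G) [H.Normal] (hp : H.index.Prime)
    [AddCommGroup W] [Module ℂ W] [FiniteDimensional ℂ W]
    {η : Representation ℂ H W} (hη : IsIrreducibleRep η)
    (hconj : ∀ (t : G) (h : H),
      LinearMap.trace ℂ W (η (MulAut.conjNormal t h)) = LinearMap.trace ℂ W (η h)) :
    ∃ ρ : Representation ℂ G W, ρ.comp H.subtype = η := by
  have := Fact.mk hp
  obtain ⟨t, ht⟩ : ∃ t, t ∉ H := by
    by_contra! h
    exact hp.ne_one (Subgroup.index_eq_one.2 (eq_top_iff.2 fun x _ => h x))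
  have ht1 : (t : G ⧸ H) ≠ 1 := by rwa [Ne, QuotientGroup.eq_one_iff]
  have hgen (g : G) : ∃ n : ℤ, ∃ h : H, g = t ^ n * h := by
    obtain ⟨n, hn⟩ := Subgroup.mem_zpowers_iff.1
      (mem_zpowers_of_prime_card (p := H.index) (g' := (g : G ⧸ H)) rfl ht1)
    refine ⟨n, ⟨(t ^ n)⁻¹ * g, ?_⟩, by simp⟩
    rw [← QuotientGroup.eq, QuotientGroup.mk_zpow, hn]
  have hord : orderOf (t : G ⧸ H) = H.index :=
    orderOf_eq_prime (pow_card_eq_one' (G := G ⧸ H)) ht1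
  have htp : t ^ H.index ∈ H := by
    rw [← QuotientGroup.eq_one_iff, QuotientGroup.mk_pow, ← hord, pow_orderOf_eq_one]
  have hdvd (n : ℤ) (hn : t ^ n ∈ H) : (H.index : ℤ) ∣ n := by
    rwa [← hord, orderOf_dvd_iff_zpow_eq_one, ← QuotientGroup.mk_zpow, QuotientGroup.eq_one_iff]
  let φ := MonoidHom.toHomUnits η
  have hσ : IsIrreducibleRep (η.comp (MulAut.conjNormal t : MulAut H).toMonoidHom) :=
    ⟨hη.1, fun U hU => hη.2 U fun h v hv => by
      simpa using hU ((MulAut.conjNormal t)⁻¹ h) v hv⟩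
  obtain ⟨e, he⟩ := hη.repEquiv_of_trace_eq hσ fun h => (hconj t h).symm
  let T₀ : (Module.End ℂ W)ˣ := LinearMap.GeneralLinearGroup.ofLinearEquiv e
  have hT₀ (h : H) : T₀ * φ h * T₀⁻¹ = φ (MulAut.conjNormal t h) := by
    rw [mul_inv_eq_iff_eq_mul]
    exact Units.ext (LinearMap.ext (he h))
  let s : H := ⟨t ^ H.index, htp⟩
  obtain ⟨c, hc⟩ := hη.exists_eq_scalarUnits ((φ s)⁻¹ * T₀ ^ H.index) fun h => by
    have hs : MulAut.conjNormal (t ^ (H.index : ℤ)) h = s * h * s⁻¹ := by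
      ext
      rw [MulAut.conjNormal_apply]
      simp [s]
    have := map_conjNormal_zpow H φ t T₀ hT₀ H.index h
    rw [hs, zpow_natCast, map_mul, map_mul, map_inv] at this
    change _ * φ h = φ h * _
    rw [mul_assoc, this]
    group
  obtain ⟨d, hd⟩ := IsAlgClosed.exists_pow_nat_eq (c⁻¹ : ℂˣ).val hp.pos
  have hd0 : d ≠ 0 := by
    rintro rfl
    rw [zero_pow hp.ne_zero] at hd
    exact (c⁻¹).ne_zero hd.symm
  have hdu : Units.mk0 d hd0 ^ H.index = c⁻¹ := Units.ext (by simpa using hd)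
  obtain ⟨ψ, hψ⟩ := exists_monoidHom_extension H φ t (scalarUnits W (Units.mk0 d hd0) * T₀)
    (fun h => by
      rw [← hT₀ h, (scalarUnits_commute _ T₀).eq, mul_assoc T₀, (scalarUnits_commute _ (φ h)).eq]
      group) H.index htp
    (by
      rw [(scalarUnits_commute _ _).mul_pow, ← map_pow, hdu, (scalarUnits_commute _ _).eq, map_inv,
        ← hc]
      change _ = φ s
      group) hdvd hgen
  exact ⟨(Units.coeHom _).comp ψ, MonoidHom.ext fun h => congrArg Units.val (hψ h)⟩

/-- The twist of a representation by a linear character. -/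
noncomputable def linearTwist {G W : Type*} [Group G] [AddCommGroup W] [Module ℂ W]
    (χ : G →* ℂˣ) (ρ : Representation ℂ G W) : Representation ℂ G W where
  toFun g := (χ g : ℂ) • ρ g
  map_one' := by simp
  map_mul' a b := by rw [map_mul, map_mul, Units.val_mul, smul_mul_smul_comm]

theorem sum_monoidHom_apply_eq_zero {Q : Type*} [CommGroup Q] [Finite Q] [Fintype (Q →* ℂˣ)]
    {q : Q} (hq : q ≠ 1) : ∑ χ : Q →* ℂˣ, (χ q : ℂ) = 0 := by
  have : NeZero (Monoid.exponent Q) := ⟨Monoid.exponent_ne_zero_of_finite⟩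
  obtain ⟨χ₀, hχ₀⟩ := CommGroup.exists_apply_ne_one_of_hasEnoughRootsOfUnity Q ℂ hq
  have h : (χ₀ q : ℂ) * ∑ χ : Q →* ℂˣ, (χ q : ℂ) = ∑ χ : Q →* ℂˣ, (χ q : ℂ) := by
    rw [Finset.mul_sum]
    exact Fintype.sum_equiv (Equiv.mulLeft χ₀) _ _ fun χ => by simp
  by_contra h0
  exact hχ₀ (Units.ext (mul_right_cancel₀ h0 (h.trans (one_mul _).symm)))

/-- Two extensions of an irreducible representation of a normal subgroup `H` differ by a linear
character of `G ⧸ H`. -/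
theorem IsIrreducibleRep.exists_repEquiv_linearTwist {G V W : Type*} [Group G]
    (H : Subgroup G) [H.Normal] [AddCommGroup V] [Module ℂ V]
    [AddCommGroup W] [Module ℂ W] [FiniteDimensional ℂ W] {ρ : Representation ℂ G W}
    (hρ : IsIrreducibleRep (ρ.comp H.subtype)) {σ : Representation ℂ G V}
    (h : RepEquiv (σ.comp H.subtype) (ρ.comp H.subtype)) :
    ∃ χ : G ⧸ H →* ℂˣ, RepEquiv σ (linearTwist (χ.comp (QuotientGroup.mk' H)) ρ) := by
  obtain ⟨e, he⟩ := h
  have := hρ.1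
  let τ : Representation ℂ G W := (e.conjRingEquiv : _ →* Module.End ℂ W).comp σ
  have hτ (g : G) (v : V) : e (σ g v) = τ g (e v) := by simp [τ]
  let t := MonoidHom.toHomUnits τ
  let r := MonoidHom.toHomUnits ρ
  have htr (h : H) : t h = r h := by
    refine Units.ext (LinearMap.ext fun w => ?_)
    obtain ⟨v, rfl⟩ := e.surjective w
    exact (hτ h v).symm.trans (he h v)
  have hscalar (g : G) : ∃ c, t g * (r g)⁻¹ = scalarUnits W c := by
    refine hρ.exists_eq_scalarUnits _ fun h => ?_
    change t g * (r g)⁻¹ * r h = r h * (t g * (r g)⁻¹)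
    have h₁ := htr (MulAut.conjNormal g⁻¹ h)
    rw [MulAut.conjNormal_apply, inv_inv, map_mul, map_mul, map_mul, map_mul, map_inv, map_inv,
      htr h] at h₁
    calc t g * (r g)⁻¹ * r h = t g * ((r g)⁻¹ * r h * r g) * (r g)⁻¹ := by group
      _ = _ := by
        rw [← h₁]
        group
  choose c hc using hscalar
  have hcr (g : G) : t g = scalarUnits W (c g) * r g := by rw [← hc, inv_mul_cancel_right]
  let χ : G →* ℂˣ := MonoidHom.mk' c fun a b => scalarUnits_injective W <| by
    rw [← hc, map_mul t, hcr a, hcr b, map_mul, map_mul, mul_assoc (scalarUnits W (c a)),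
      ← mul_assoc (r a), ← (scalarUnits_commute _ (r a)).eq]
    group
  have hχ (h : G) (hh : h ∈ H) : χ h = 1 := scalarUnits_injective W <| by
    change scalarUnits W (c h) = _
    rw [← hc, htr ⟨h, hh⟩, mul_inv_cancel, map_one]
  refine ⟨QuotientGroup.lift H χ hχ, e, fun g v => ?_⟩
  rw [hτ]
  exact LinearMap.congr_fun (congrArg Units.val (hcr g)) (e v)

/-- Twists of an extension by distinct linear characters of `G ⧸ H` are inequivalent. -/
theorem IsIrreducibleRep.eq_of_repEquiv_linearTwist {G W : Type*} [Group G]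
    (H : Subgroup G) [H.Normal] [AddCommGroup W] [Module ℂ W] [FiniteDimensional ℂ W]
    {ρ : Representation ℂ G W} (hρ : IsIrreducibleRep (ρ.comp H.subtype)) {χ ψ : G ⧸ H →* ℂˣ}
    (h : RepEquiv (linearTwist (χ.comp (QuotientGroup.mk' H)) ρ)
      (linearTwist (ψ.comp (QuotientGroup.mk' H)) ρ)) : χ = ψ := by
  obtain ⟨e, he⟩ := h
  have := hρ.1
  obtain ⟨c, hc⟩ := hρ.exists_eq_smul_one e.toLinearMap fun h => by
    ext v
    have h1 : ((h : G) : G ⧸ H) = 1 := (QuotientGroup.eq_one_iff _).2 h.2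
    simpa [linearTwist, h1] using he h v
  have hc' (v : W) : e v = c • v := LinearMap.congr_fun hc v
  obtain ⟨v, hv⟩ := exists_ne (0 : W)
  have hc0 : c ≠ 0 := by
    rintro rfl
    exact hv (e.injective (by simp [hc']))
  refine QuotientGroup.monoidHom_ext _ (MonoidHom.ext fun g => Units.ext ?_)
  have hg : ρ g v ≠ 0 := fun h0 => hv (by simpa [h0] using (ρ.inv_self_apply g v).symm)
  have := he g v
  simp only [hc', linearTwist, MonoidHom.coe_mk, OneHom.coe_mk, LinearMap.smul_apply, map_smul,
    smul_comm c] at this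
  exact smul_left_injective ℂ (smul_ne_zero hc0 hg) this

/-- The idempotents of all twists by linear characters of `G ⧸ H` sum to the idempotent of the
restriction to `H`. -/
theorem sum_pciMap_linearTwist {G W : Type*} [Group G] [Finite G] (H : Subgroup G) [H.Normal]
    [AddCommGroup W] [Module ℂ W] (ρ : Representation ℂ G W) [Fintype (G ⧸ H →* ℂˣ)]
    (hcard : Nat.card (G ⧸ H →* ℂˣ) = H.index)
    (hsum : ∀ q : G ⧸ H, q ≠ 1 → ∑ χ : G ⧸ H →* ℂˣ, (χ q : ℂ) = 0) :
    ∑ χ : G ⧸ H →* ℂˣ, pciMap (MonoidHom.id G) (linearTwist (χ.comp (QuotientGroup.mk' H)) ρ) =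
      pciMap H.subtype (ρ.comp H.subtype) := by
  have := Fintype.ofFinite G
  have := Fintype.ofFinite H
  classical
  have hG : (Nat.card G : ℂ) = Nat.card H * H.index := by
    rw [← Nat.cast_mul, H.card_mul_index]
  have hi : (H.index : ℂ) ≠ 0 := Nat.cast_ne_zero.2 H.index_ne_zero_of_finite
  have hcoeff (g : G) : ∑ χ : G ⧸ H →* ℂˣ, ((Module.finrank ℂ W : ℂ) / (Nat.card G : ℂ) *
      LinearMap.trace ℂ W (linearTwist (χ.comp (QuotientGroup.mk' H)) ρ g⁻¹)) =
      if g ∈ H then (Module.finrank ℂ W : ℂ) / (Nat.card H : ℂ) *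
        LinearMap.trace ℂ W (ρ g⁻¹) else 0 := by
    simp only [linearTwist, MonoidHom.coe_mk, OneHom.coe_mk, map_smul, smul_eq_mul,
      ← Finset.mul_sum, ← Finset.sum_mul]
    split_ifs with hg
    · have h1 : ((g⁻¹ : G) : G ⧸ H) = 1 := (QuotientGroup.eq_one_iff _).2 (inv_mem hg)
      simp [h1, -QuotientGroup.mk_inv, ← Nat.card_eq_fintype_card, hcard, hG]
      field_simp
    · have h1 : ((g⁻¹ : G) : G ⧸ H) ≠ 1 := fun h => hg (by
        simpa using (QuotientGroup.eq_one_iff _).1 h)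
      have := hsum _ h1
      simp [this, -QuotientGroup.mk_inv]
  simp only [pciMap]
  rw [Finset.sum_comm]
  simp only [← Finset.sum_smul]
  trans ∑ g : G, if g ∈ H then ((Module.finrank ℂ W : ℂ) / (Nat.card H : ℂ) *
      LinearMap.trace ℂ W (ρ g⁻¹)) • MonoidAlgebra.of ℂ G g else 0
  · refine Finset.sum_congr (by congr!) fun g _ => ?_
    rw [hcoeff, ite_smul, zero_smul]
    rfl
  · rw [← Finset.sum_filter,
      Finset.sum_subtype (F := Fintype.ofFinite H) _ (p := (· ∈ H)) (by simp)]
    rfl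

/-- Let `G` be a finite group, `H ⊴ G` of prime index `p`, `η` an irreducible
complex representation of `H` with primitive central idempotent `e_η ∈ ℂ[H] ⊆ ℂ[G]`.  If
`e_η` is central in `ℂ[G]`, then there exist exactly `p` pairwise inequivalent irreducible
complex representations `ρ_0, …, ρ_{p-1}` of `G` whose restriction to `H` is equivalent to
`η`, and `e_η = e_{ρ_0} + ⋯ + e_{ρ_{p-1}}`. -/
theorem stmt15 {G : Type*} [Group G] [Fintype G] (H : Subgroup G) [H.Normal]
    (p : ℕ) (hp : p.Prime) (hidx : H.index = p)
    {W : Type*} [AddCommGroup W] [Module ℂ W] [FiniteDimensional ℂ W]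
    (η : Representation ℂ H W) (hη : IsIrreducibleRep η)
    (hcentral : pciMap H.subtype η ∈ Set.center (MonoidAlgebra ℂ G)) :
    ∃ ρ : Fin p → Representation ℂ G W,
      (∀ i, IsIrreducibleRep (ρ i)) ∧
      (∀ i, RepEquiv ((ρ i).comp H.subtype) η) ∧
      (∀ i j, i ≠ j → ¬ RepEquiv (ρ i) (ρ j)) ∧
      (∀ (V : Type*) [AddCommGroup V] [Module ℂ V] (σ : Representation ℂ G V),
        IsIrreducibleRep σ → RepEquiv (σ.comp H.subtype) η → ∃ i, RepEquiv σ (ρ i)) ∧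
      pciMap H.subtype η = ∑ i : Fin p, pciMap (MonoidHom.id G) (ρ i) := by
  have := Fact.mk hp
  have hη' (t : G) (h : H) :
      LinearMap.trace ℂ W (η (MulAut.conjNormal t h)) = LinearMap.trace ℂ W (η h) := by
    have := hη.1
    have hd : (Module.finrank ℂ W : ℂ) / (Nat.card H : ℂ) ≠ 0 :=
      div_ne_zero (Nat.cast_ne_zero.2 Module.finrank_pos.ne')
        (Nat.cast_ne_zero.2 Nat.card_pos.ne')
    have := @coeff_conjNormal_of_sum_mem_center _ _ H _ (Fintype.ofFinite H) _ hcentral t h⁻¹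
    simpa [hd] using this
  obtain ⟨ρ, rfl⟩ := hη.exists_extension H (hidx ▸ hp) hη'
  have : IsCyclic (G ⧸ H) := isCyclic_of_prime_card (p := p) hidx
  let _ : CommGroup (G ⧸ H) := IsCyclic.commGroup
  have : NeZero (Monoid.exponent (G ⧸ H)) := ⟨Monoid.exponent_ne_zero_of_finite⟩
  have hcard : Nat.card (G ⧸ H →* ℂˣ) = H.index :=
    CommGroup.card_monoidHom_of_hasEnoughRootsOfUnity (G ⧸ H) ℂ
  have : Finite (G ⧸ H →* ℂˣ) := Nat.finite_of_card_ne_zero (hcard ▸ hidx ▸ hp.ne_zero)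
  have := Fintype.ofFinite (G ⧸ H →* ℂˣ)
  let χ := (Finite.equivFinOfCardEq (hcard.trans hidx)).symm
  let τ (i : Fin p) := linearTwist ((χ i).comp (QuotientGroup.mk' H)) ρ
  have hτ (i : Fin p) : (τ i).comp H.subtype = ρ.comp H.subtype := by
    ext h : 1
    have h1 : ((h : G) : G ⧸ H) = 1 := (QuotientGroup.eq_one_iff _).2 h.2
    simp [τ, linearTwist, h1]
  refine ⟨τ, fun i => ⟨hη.1, fun U hU => hη.2 U fun h v hv => ?_⟩, fun i => ?_,
    fun i j hij h => hij (χ.injective (hη.eq_of_repEquiv_linearTwist H h)), ?_, ?_⟩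
  · rw [← hτ i]
    exact hU h v hv
  · rw [hτ]
    exact ⟨LinearEquiv.refl ℂ W, fun _ _ => rfl⟩
  · intro V _ _ σ _ h
    obtain ⟨ψ, hψ⟩ := hη.exists_repEquiv_linearTwist H h
    exact ⟨χ.symm ψ, by simpa [τ] using hψ⟩
  · rw [← sum_pciMap_linearTwist H ρ hcard fun q hq => sum_monoidHom_apply_eq_zero hq]
    exact (Fintype.sum_equiv χ _ _ fun i => rfl).symm
end

section
/- Let G be a finite group, H a normal subgroup of prime index p, η an irreducible complex representation of H with primitive central idempotent e_η ∈ ℂ[H] ⊆ ℂ[G], and suppose e_η is central in ℂ[G]. Then there exists x ∈ G ∖ H with xH generating G/H such that C̄(x)^p e_η = λ e_η for some nonzero scalar λ ∈ ℂ, where C̄(x) is the conjugacy class sum of x in G. Moreover, for any p-th root μ of λ, setting c = C̄(x) e_η / μ and fixing a primitive p-th root of unity ζ ∈ ℂ, the p elements f_i = (1/p)(1 + ζ^i c + ζ^{2i} c^2 + ⋯ + ζ^{(p−1)i} c^{p−1}) e_η, for i = 0, 1, …, p−1, are exactly the primitive central idempotents of ℂ[G] lying in the two-sided ideal ℂ[G]e_η,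 i.e. they are the primitive central idempotents e_{ρ_0}, …, e_{ρ_{p−1}} of the p extensions ρ_0, …, ρ_{p−1} of η to G. -/
open scoped Classical

/-- A primitive central idempotent of a ring: a nonzero central idempotent which cannot be
written as the sum of two nonzero orthogonal central idempotents. -/
def IsPrimitiveCentralIdempotent {R : Type*} [Ring R] (e : R) : Prop :=
  IsIdempotentElem e ∧ e ∈ Set.center R ∧ e ≠ 0 ∧
    ∀ f g : R, IsIdempotentElem f → IsIdempotentElem g → f ∈ Set.center R →
      g ∈ Set.center R → f * g = 0 → e = f + g → f = 0 ∨ g = 0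

/-- The conjugacy class sum of `x` in the complex group algebra `ℂ[G]`. -/
noncomputable def classSum {G : Type*} [Group G] [Fintype G] (x : G) :
    MonoidAlgebra ℂ G :=
  ∑ g : G, if IsConj x g then MonoidAlgebra.of ℂ G g else 0

section GroupAlgebra

variable {K G W : Type*} [Group K] [Group G] [AddCommGroup W] [Module ℂ W]

lemma IsIrreducibleRep.exists_eq_smul_one_s16 [FiniteDimensional ℂ W] {η : Representation ℂ K W}
    (hη : IsIrreducibleRep η) (T : Module.End ℂ W) (hT : ∀ g, T * η g = η g * T) :
    ∃ a : ℂ, T = a • (1 : Module.End ℂ W) := by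
  have := hη.1
  obtain ⟨a, ha⟩ := Module.End.exists_eigenvalue T
  refine ⟨a, ?_⟩
  rcases hη.2 (Module.End.eigenspace T a) (fun g v hv => by
    rw [Module.End.mem_eigenspace_iff] at hv ⊢
    have := congrArg (fun f : Module.End ℂ W => f v) (hT g)
    simp only [Module.End.mul_apply] at this
    rw [this, hv, map_smul]) with h | h
  · exact absurd h ha
  · ext v
    have : v ∈ Module.End.eigenspace T a := h ▸ Submodule.mem_top
    simpa [Module.End.mem_eigenspace_iff] using this

lemma Representation.sum_conj_commute [Fintype K] (η : Representation ℂ K W)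
    (X : Module.End ℂ W) (g : K) :
    (∑ h, η h * X * η h⁻¹) * η g = η g * ∑ h, η h * X * η h⁻¹ := by
  rw [Finset.sum_mul, Finset.mul_sum]
  refine Fintype.sum_equiv (Equiv.mulLeft g⁻¹) _ _ fun h => ?_
  rw [Equiv.coe_mulLeft, mul_assoc, ← map_mul, ← mul_assoc, ← mul_assoc, ← map_mul]
  simp

lemma IsIrreducibleRep.sum_conj [Fintype K] [FiniteDimensional ℂ W] {η : Representation ℂ K W}
    (hη : IsIrreducibleRep η) (X : Module.End ℂ W) :
    ((Module.finrank ℂ W : ℂ) / Nat.card K) • ∑ h, η h * X * η h⁻¹ =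
      LinearMap.trace ℂ W X • (1 : Module.End ℂ W) := by
  have := hη.1
  obtain ⟨a, ha⟩ := hη.exists_eq_smul_one_s16 _ (η.sum_conj_commute X)
  have htr := congrArg (LinearMap.trace ℂ W) ha
  have hconj : ∀ h, LinearMap.trace ℂ W (η h * X * η h⁻¹) = LinearMap.trace ℂ W X := fun h => by
    rw [LinearMap.trace_mul_comm, ← mul_assoc, ← map_mul]
    simp
  have hd : (Module.finrank ℂ W : ℂ) ≠ 0 := by exact_mod_cast Module.finrank_pos.ne'
  have hK : (Fintype.card K : ℂ) ≠ 0 := by exact_mod_cast Fintype.card_ne_zero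
  simp only [map_sum, hconj, Finset.sum_const, Finset.card_univ, nsmul_eq_mul, map_smul,
    LinearMap.trace_one, smul_eq_mul] at htr
  rw [ha, smul_smul, Nat.card_eq_fintype_card]
  congr 1
  field_simp
  linear_combination -htr

lemma IsIrreducibleRep.sum_trace_smul [Fintype K] [FiniteDimensional ℂ W]
    {η : Representation ℂ K W} (hη : IsIrreducibleRep η) (M : Module.End ℂ W) :
    ∑ h, ((Module.finrank ℂ W : ℂ) / Nat.card K * LinearMap.trace ℂ W (M * η h⁻¹)) • η h = M := by
  have key : ∀ (f : Module.Dual ℂ W) (v : W),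
      ∑ h, ((Module.finrank ℂ W : ℂ) / Nat.card K *
        LinearMap.trace ℂ W ((f.smulRight v : Module.End ℂ W) * η h⁻¹)) • η h =
          f.smulRight v := by
    intro f v
    ext w
    have h1 := congrArg (fun T : Module.End ℂ W => T v) (hη.sum_conj (f.smulRight w))
    have h2 : ∀ h, (f.smulRight v : Module.End ℂ W) * η h⁻¹ = (f ∘ₗ η h⁻¹).smulRight v :=
      fun h => by ext; simp
    simp only [h2, LinearMap.trace_smulRight]
    simpa [Finset.smul_sum, smul_smul] using h1
  have hM : M = ∑ i, ((Module.finBasis ℂ W).coord i).smulRight (M (Module.finBasis ℂ W i)) := by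
    refine (Module.finBasis ℂ W).ext fun j => ?_
    simp [LinearMap.sum_apply, Finsupp.single_apply]
  conv_rhs => rw [hM]
  rw [Finset.sum_congr rfl fun i _ => (key _ _).symm, Finset.sum_comm]
  refine Finset.sum_congr rfl fun h _ => ?_
  rw [← Finset.sum_smul, ← Finset.mul_sum, ← map_sum, ← Finset.sum_mul, ← hM]

/-- The linear map `End W → ℂ[G]` sending `M` to
`(deg η / |K|) ∑ₖ tr (M η(k⁻¹)) φ(k)`; at `M = 1` it is `pciMap φ η`. -/
noncomputable def endToGroupAlgebra [Fintype K] (φ : K →* G) (η : Representation ℂ K W) :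
    Module.End ℂ W →ₗ[ℂ] MonoidAlgebra ℂ G where
  toFun M := ∑ k, ((Module.finrank ℂ W : ℂ) / Nat.card K * LinearMap.trace ℂ W (M * η k⁻¹)) •
    MonoidAlgebra.of ℂ G (φ k)
  map_add' M N := by simp only [add_mul, map_add, mul_add, add_smul, Finset.sum_add_distrib]
  map_smul' a M := by
    simp only [smul_mul_assoc, map_smul, Finset.smul_sum, smul_smul, smul_eq_mul,
      RingHom.id_apply]
    exact Finset.sum_congr rfl fun k _ => by rw [mul_left_comm]

lemma endToGroupAlgebra_apply [Fintype K] (φ : K →* G) (η : Representation ℂ K W)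
    (M : Module.End ℂ W) : endToGroupAlgebra φ η M =
      ∑ k, ((Module.finrank ℂ W : ℂ) / Nat.card K * LinearMap.trace ℂ W (M * η k⁻¹)) •
        MonoidAlgebra.of ℂ G (φ k) := rfl

lemma endToGroupAlgebra_one [Fintype K] (φ : K →* G) (η : Representation ℂ K W) :
    endToGroupAlgebra φ η 1 = pciMap φ η := by
  simp only [endToGroupAlgebra_apply, pciMap, one_mul]
  congr!

lemma of_mul_endToGroupAlgebra [Fintype K] (φ : K →* G) (η : Representation ℂ K W) (g : K)
    (M : Module.End ℂ W) :
    MonoidAlgebra.of ℂ G (φ g) * endToGroupAlgebra φ η M = endToGroupAlgebra φ η (η g * M) := by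
  simp only [endToGroupAlgebra_apply, Finset.mul_sum, mul_smul_comm, ← map_mul]
  refine Fintype.sum_equiv (Equiv.mulLeft g) _ _ fun h => ?_
  rw [LinearMap.trace_mul_comm ℂ (η g * M), ← mul_assoc, ← map_mul, Equiv.coe_mulLeft,
    LinearMap.trace_mul_comm ℂ M]
  simp

lemma endToGroupAlgebra_mul_of [Fintype K] (φ : K →* G) (η : Representation ℂ K W) (g : K)
    (M : Module.End ℂ W) :
    endToGroupAlgebra φ η M * MonoidAlgebra.of ℂ G (φ g) = endToGroupAlgebra φ η (M * η g) := by
  simp only [endToGroupAlgebra_apply, Finset.sum_mul, smul_mul_assoc, ← map_mul]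
  refine Fintype.sum_equiv (Equiv.mulRight g) _ _ fun h => ?_
  rw [mul_assoc M, ← map_mul]
  simp

lemma IsIrreducibleRep.endToGroupAlgebra_mul [Fintype K] [FiniteDimensional ℂ W] (φ : K →* G)
    {η : Representation ℂ K W} (hη : IsIrreducibleRep η) (M N : Module.End ℂ W) :
    endToGroupAlgebra φ η (M * N) = endToGroupAlgebra φ η M * endToGroupAlgebra φ η N := by
  conv_lhs => rw [← hη.sum_trace_smul M]
  conv_rhs => rw [endToGroupAlgebra_apply φ η M]
  simp only [Finset.sum_mul, smul_mul_assoc, of_mul_endToGroupAlgebra, map_sum, map_smul]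

lemma coeff_endToGroupAlgebra [Fintype K] {φ : K →* G} (hφ : Function.Injective φ)
    (η : Representation ℂ K W) (M : Module.End ℂ W) (k : K) :
    (endToGroupAlgebra φ η M).coeff (φ k) =
      (Module.finrank ℂ W : ℂ) / Nat.card K * LinearMap.trace ℂ W (M * η k⁻¹) := by
  rw [endToGroupAlgebra_apply]
  simp [Finsupp.single_apply, hφ.eq_iff]

lemma IsIrreducibleRep.endToGroupAlgebra_injective [Fintype K] [FiniteDimensional ℂ W]
    {φ : K →* G} (hφ : Function.Injective φ) {η : Representation ℂ K W}
    (hη : IsIrreducibleRep η) : Function.Injective (endToGroupAlgebra φ η) := by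
  rw [injective_iff_map_eq_zero]
  intro M hM
  rw [← hη.sum_trace_smul M]
  refine Finset.sum_eq_zero fun k _ => ?_
  rw [← coeff_endToGroupAlgebra hφ, hM]
  simp

/-- Skolem–Noether for the block of `ℂ[K]` cut out by a `G`-stable idempotent. -/
lemma IsIrreducibleRep.exists_conj_endToGroupAlgebra [Fintype K] [FiniteDimensional ℂ W]
    {φ : K →* G} (hφ : Function.Injective φ) {η : Representation ℂ K W}
    (hη : IsIrreducibleRep η) (hc : ∀ r, Commute (pciMap φ η) r) (t : G) (τ : K → K)
    (hτ : ∀ k, φ (τ k) = t * φ k * t⁻¹) :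
    ∃ u : (Module.End ℂ W)ˣ, ∀ M, MonoidAlgebra.of ℂ G t * endToGroupAlgebra φ η M =
      endToGroupAlgebra φ η (u * M * ↑u⁻¹) * MonoidAlgebra.of ℂ G t := by
  set S := endToGroupAlgebra φ η
  set T : MonoidAlgebra ℂ G := MonoidAlgebra.of ℂ G t
  set T' : MonoidAlgebra ℂ G := MonoidAlgebra.of ℂ G t⁻¹
  have hTT' : T * T' = 1 := by rw [← map_mul, mul_inv_cancel, map_one]
  have hT'T : T' * T = 1 := by rw [← map_mul, inv_mul_cancel, map_one]
  have hmul : ∀ M N, S (M * N) = S M * S N := hη.endToGroupAlgebra_mul φ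
  have hS : Function.Injective S := hη.endToGroupAlgebra_injective hφ
  have h1 : ∀ r, S 1 * r = r * S 1 := by
    simp only [S, endToGroupAlgebra_one]
    exact hc
  let α (M : Module.End ℂ W) : Module.End ℂ W :=
    ∑ k, ((Module.finrank ℂ W : ℂ) / Nat.card K * LinearMap.trace ℂ W (M * η k⁻¹)) • η (τ k)
  have hα : ∀ M, S (α M) = T * S M * T' := by
    intro M
    have : T * S M * T' = T * S M * T' * S 1 := by
      rw [mul_assoc _ T', ← h1 T', ← mul_assoc, mul_assoc T (S M) (S 1), ← hmul, mul_one]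
    rw [this]
    simp only [α, map_sum, map_smul]
    conv_rhs => rw [show S M = _ from endToGroupAlgebra_apply φ η M]
    simp only [Finset.mul_sum, Finset.sum_mul, mul_smul_comm, smul_mul_assoc]
    refine Finset.sum_congr rfl fun k _ => ?_
    congr 1
    rw [← map_mul, ← map_mul, ← hτ, of_mul_endToGroupAlgebra, mul_one]
  let αHom : Module.End ℂ W →ₐ[ℂ] Module.End ℂ W := AlgHom.ofLinearMap
    { toFun := α
      map_add' := fun M N => hS (by simp only [hα, map_add, mul_add, add_mul])
      map_smul' := fun a M => hS (by
        simp only [hα, map_smul, mul_smul_comm, smul_mul_assoc, RingHom.id_apply]) }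
    (hS (by
      show S (α 1) = S 1
      rw [hα, ← h1, mul_assoc, hTT', mul_one]))
    (fun M N => hS (by
      show S (α (M * N)) = S (α M * α N)
      rw [hmul, hα, hα, hα, hmul]
      simp only [mul_assoc]
      rw [← mul_assoc T' T, hT'T, one_mul]))
  have hinj : Function.Injective αHom := by
    rw [injective_iff_map_eq_zero]
    intro M hM
    apply hS
    have h0 : S (α M) = 0 := by rw [show α M = 0 from hM, map_zero]
    rw [hα] at h0
    have h2 : T' * (T * S M * T') * T = S M := by
      simp only [mul_assoc]
      rw [hT'T, mul_one, ← mul_assoc, hT'T, one_mul]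
    rw [← h2, h0]
    simp
  have hsurj : Function.Surjective αHom :=
    LinearMap.surjective_of_injective (f := αHom.toLinearMap) hinj
  obtain ⟨u, hu⟩ := (AlgEquiv.ofBijective αHom ⟨hinj, hsurj⟩).eq_linearEquivConjAlgEquiv
  refine ⟨LinearMap.GeneralLinearGroup.ofLinearEquiv u, fun M => ?_⟩
  have h3 : α M = (LinearMap.GeneralLinearGroup.ofLinearEquiv u : Module.End ℂ W) * M *
      ((LinearMap.GeneralLinearGroup.ofLinearEquiv u)⁻¹ : (Module.End ℂ W)ˣ) :=
    congrArg (fun F : Module.End ℂ W ≃ₐ[ℂ] Module.End ℂ W => F M) hu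
  rw [← h3, hα, mul_assoc, hT'T, mul_one]

end GroupAlgebra

section FourierIdempotents

lemma IsPrimitiveRoot.sum_range_pow_div_eq_zero {k : Type*} [Field k] {ζ : k} {p : ℕ}
    (hζ : IsPrimitiveRoot ζ p) {i j : Fin p} (hij : i ≠ j) :
    ∑ n ∈ Finset.range p, (ζ ^ (i : ℕ) * (ζ ^ (j : ℕ))⁻¹) ^ n = 0 := by
  have hζ0 : ζ ≠ 0 := hζ.ne_zero (Nat.ne_of_gt i.pos)
  have hw : ζ ^ (i : ℕ) * (ζ ^ (j : ℕ))⁻¹ - 1 ≠ 0 := by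
    intro h
    apply hij
    rw [sub_eq_zero, mul_inv_eq_one₀ (pow_ne_zero _ hζ0)] at h
    exact Fin.ext (hζ.pow_inj i.isLt j.isLt h)
  apply mul_left_cancel₀ hw
  rw [mul_geom_sum, mul_zero, mul_pow, inv_pow, pow_right_comm ζ i, pow_right_comm ζ j,
    hζ.pow_eq_one]
  simp

/-- If `e` is a central idempotent of `R` and `c` a central element with `c ^ p = e` whose powers
span the centre of `R e`, then the Fourier projections of `c` are the primitive central
idempotents of `R` lying in `R e`, as soon as they are nonzero. -/
theorem isPrimitiveCentralIdempotent_iff_fourier {k R : Type*} [Field k] [Ring R] [Algebra k R]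
    {p : ℕ} (hp : (p : k) ≠ 0) {ζ : k} (hζ : IsPrimitiveRoot ζ p) {e c : R}
    (he : IsIdempotentElem e) (hec : ∀ r, Commute e r) (hc : ∀ r, Commute c r)
    (hcp : c ^ p = e) {f : Fin p → R}
    (hf : ∀ i, f i = (p : k)⁻¹ • ((∑ n ∈ Finset.range p, ζ ^ ((i : ℕ) * n) • c ^ n) * e))
    (hne : ∀ i, f i ≠ 0)
    (hspan : ∀ E : R, E ∈ Set.center R → E * e = E →
      E ∈ Submodule.span k (Set.range fun n : ℕ => c ^ n * e)) :
    Function.Injective f ∧ ∀ E : R,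
      (IsPrimitiveCentralIdempotent E ∧ E * e = E) ↔ ∃ i, E = f i := by
  have hp0 : p ≠ 0 := by rintro rfl; simp at hp
  have hζ0 : ζ ≠ 0 := hζ.ne_zero hp0
  have hfe : ∀ i, f i * e = f i := fun i => by
    rw [hf, smul_mul_assoc, mul_assoc, he.eq]
  have hefi : ∀ i, e * f i = f i := fun i => by rw [(hec _).eq, hfe]
  have hcf : ∀ i, c * f i = (ζ ^ (i : ℕ))⁻¹ • f i := by
    intro i
    have hy : (ζ ^ (i : ℕ) • c) * f i = f i := by
      rw [← sub_eq_zero, ← sub_one_mul, hf, mul_smul_comm, ← mul_assoc]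
      simp only [pow_mul, ← smul_pow]
      rw [mul_geom_sum, smul_pow, ← pow_mul, mul_comm, pow_mul, hζ.pow_eq_one, one_pow, one_smul,
        hcp, sub_one_mul, he.eq, sub_self, smul_zero]
    rw [smul_mul_assoc] at hy
    rw [← hy, smul_smul, inv_mul_cancel₀ (pow_ne_zero _ hζ0), one_smul, hy]
  have hcnf : ∀ (n : ℕ) i, c ^ n * f i = ((ζ ^ (i : ℕ))⁻¹) ^ n • f i := by
    intro n i
    induction n with
    | zero => simp
    | succ n ih => rw [pow_succ, mul_assoc, hcf, mul_smul_comm, ih, smul_smul, pow_succ']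
  have hff : ∀ i j, f i * f j =
      ((p : k)⁻¹ * ∑ n ∈ Finset.range p, (ζ ^ (i : ℕ) * (ζ ^ (j : ℕ))⁻¹) ^ n) • f j := by
    intro i j
    rw [hf i, smul_mul_assoc, mul_assoc, hefi, Finset.sum_mul, mul_smul, Finset.sum_smul]
    congr 1
    refine Finset.sum_congr rfl fun n _ => ?_
    rw [smul_mul_assoc, hcnf, smul_smul, mul_pow, pow_mul]
  have horth : ∀ i j, i ≠ j → f i * f j = 0 := fun i j hij => by
    rw [hff, hζ.sum_range_pow_div_eq_zero hij, mul_zero, zero_smul]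
  have hidem : ∀ i, f i * f i = f i := fun i => by
    rw [hff, mul_inv_cancel₀ (pow_ne_zero _ hζ0)]
    simp [inv_mul_cancel₀ hp]
  have hinj : Function.Injective f := fun i j hij => by
    by_contra h
    apply hne i
    rw [← hidem i]
    nth_rw 2 [hij]
    exact horth i j h
  have hsum : ∑ i, f i = e := by
    have h1 : ∀ n ∈ Finset.range p, n ≠ 0 →
        ∑ i ∈ Finset.range p, ζ ^ (i * n) = 0 := by
      intro n hn hn0
      have hnp := Finset.mem_range.1 hn
      have := hζ.sum_range_pow_div_eq_zero (i := ⟨n, hnp⟩) (j := ⟨0, by omega⟩) (by simpa using hn0)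
      simpa [← pow_mul, mul_comm] using this
    simp only [hf]
    rw [← Finset.smul_sum, ← Finset.sum_mul,
      Fin.sum_univ_eq_sum_range (fun i => ∑ n ∈ Finset.range p, ζ ^ (i * n) • c ^ n),
      Finset.sum_comm]
    simp only [← Finset.sum_smul]
    rw [Finset.sum_eq_single 0 (fun n hn hn0 => by rw [h1 n hn hn0, zero_smul])
      (fun h => absurd (Finset.mem_range.2 (Nat.pos_of_ne_zero hp0)) h)]
    simp [smul_smul, inv_mul_cancel₀ hp]
  have hfcenter : ∀ i, f i ∈ Set.center R := by
    intro i
    have hcc : c ∈ Subalgebra.center k R := Subalgebra.mem_center_iff.2 fun r => (hc r).eq.symm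
    have hee : e ∈ Subalgebra.center k R := Subalgebra.mem_center_iff.2 fun r => (hec r).eq.symm
    have : f i ∈ Subalgebra.center k R := by
      rw [hf]
      exact Subalgebra.smul_mem _ (mul_mem (sum_mem fun n _ =>
        Subalgebra.smul_mem _ (pow_mem hcc n) _) hee) _
    exact this
  have hscal : ∀ E ∈ Set.center R, E * e = E → ∀ i, ∃ a : k, E * f i = a • f i := by
    intro E hE hEe i
    refine Submodule.span_induction (p := fun E _ => ∃ a : k, E * f i = a • f i) ?_ ?_ ?_ ?_
      (hspan E hE hEe)
    · rintro _ ⟨n, rfl⟩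
      exact ⟨_, by simp only [mul_assoc, hefi]; exact hcnf n i⟩
    · exact ⟨0, by simp⟩
    · rintro x y - - ⟨a, ha⟩ ⟨b, hb⟩
      exact ⟨a + b, by rw [add_mul, ha, hb, add_smul]⟩
    · rintro r x - ⟨a, ha⟩
      exact ⟨r * a, by rw [smul_mul_assoc, ha, smul_smul]⟩
  refine ⟨hinj, fun E => ⟨?_, ?_⟩⟩
  · rintro ⟨⟨hEi, hEc, hE0, hEp⟩, hEe⟩
    have hcomm : ∀ r, r * E = E * r := Semigroup.mem_center_iff.1 hEc
    obtain ⟨i, hi⟩ : ∃ i, E * f i ≠ 0 := by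
      by_contra! h
      apply hE0
      rw [← hEe, ← hsum, Finset.mul_sum, Finset.sum_eq_zero fun i _ => h i]
    refine ⟨i, ?_⟩
    obtain ⟨a, ha⟩ := hscal E hEc hEe i
    have hidm : IsIdempotentElem (E * f i) := by
      unfold IsIdempotentElem
      rw [mul_assoc, ← mul_assoc (f i), hcomm, mul_assoc E (f i), hidem, ← mul_assoc, hEi.eq]
    have hEE : E * (E * f i) = E * f i := by rw [← mul_assoc, hEi.eq]
    have hEE' : (E * f i) * E = E * f i := by rw [hcomm, hEE]
    have hmem : E * f i ∈ Set.center R := Set.mul_mem_center hEc (hfcenter i)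
    have hsub : E - E * f i ∈ Set.center R :=
      Semigroup.mem_center_iff.2 fun r => by
        rw [mul_sub, sub_mul, hcomm, Semigroup.mem_center_iff.1 hmem r]
    rcases hEp (E * f i) (E - E * f i) hidm
      (by unfold IsIdempotentElem
          rw [mul_sub, sub_mul, sub_mul, hEi.eq, hEE, hEE', hidm.eq, sub_self, sub_zero])
      hmem hsub (by rw [mul_sub, hEE', hidm.eq, sub_self]) (by abel) with h | h
    · exact absurd h hi
    · rw [sub_eq_zero] at h
      have ha' : a • (f i) = (a * a) • f i := by
        have := hidm.eq
        rw [ha, smul_mul_smul_comm, hidem] at this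
        exact this.symm
      have ha0 : a ≠ 0 := by
        rintro rfl
        exact hi (by rw [ha, zero_smul])
      have ha1 : a = 1 := by
        have := smul_left_injective k (hne i) ha'
        exact mul_left_cancel₀ ha0 (by rw [mul_one]; exact this.symm)
      rw [h, ha, ha1, one_smul]
  · rintro ⟨i, rfl⟩
    refine ⟨⟨hidem i, hfcenter i, hne i, fun x y hx hy hxc hyc hxy hsum' => ?_⟩, hfe i⟩
    have hyx : y * x = 0 := by rw [Semigroup.mem_center_iff.1 hxc, hxy]
    have hxf : x * f i = x := by rw [hsum', mul_add, hx.eq, hxy, add_zero]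
    have hyf : y * f i = y := by rw [hsum', mul_add, hy.eq, hyx, zero_add]
    obtain ⟨a, ha⟩ := hscal x hxc (by rw [← hxf, mul_assoc, hfe]) i
    obtain ⟨b, hb⟩ := hscal y hyc (by rw [← hyf, mul_assoc, hfe]) i
    rw [hxf] at ha
    rw [hyf] at hb
    rw [ha, hb, smul_mul_smul_comm, hidem, smul_eq_zero, or_iff_left (hne i), mul_eq_zero] at hxy
    exact hxy.imp (fun h => by rw [ha, h, zero_smul]) (fun h => by rw [hb, h, zero_smul])

end FourierIdempotents

section ClassSum

variable {G : Type*} [Group G]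

lemma MonoidAlgebra.commute_of_forall_of {k : Type*} [CommSemiring k] {r : MonoidAlgebra k G}
    (h : ∀ g, Commute r (MonoidAlgebra.of k G g)) (s : MonoidAlgebra k G) : Commute r s := by
  induction s using MonoidAlgebra.induction_on with
  | of g => exact h g
  | add f g hf hg => exact hf.add_right hg
  | smul a f hf => exact hf.smul_right a

lemma MonoidAlgebra.coeff_eq_of_isConj {k : Type*} [CommSemiring k] {r : MonoidAlgebra k G}
    (hr : ∀ s, Commute r s) {g h : G} (hgh : IsConj g h) : r.coeff g = r.coeff h := by
  obtain ⟨y, rfl⟩ := isConj_iff.1 hgh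
  have := congrArg (fun s => s.coeff (y * g)) (hr (MonoidAlgebra.single y 1)).eq
  simpa using this.symm

variable [Fintype G]

lemma coeff_classSum (x g : G) : (classSum x).coeff g = if IsConj x g then 1 else 0 := by
  rw [classSum, MonoidAlgebra.coeff_sum, Finsupp.finsetSum_apply,
    Finset.sum_eq_single g (fun y _ hy => by split_ifs <;> simp [hy]) (by simp)]
  split_ifs <;> simp

lemma classSum_commute (x : G) (r : MonoidAlgebra ℂ G) : Commute (classSum x) r := by
  refine MonoidAlgebra.commute_of_forall_of (fun y => ?_) r
  ext h
  have : IsConj x (h * y⁻¹) ↔ IsConj x (y⁻¹ * h) := by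
    have hc : IsConj (h * y⁻¹) (y⁻¹ * h) := isConj_iff.2 ⟨y⁻¹, by group⟩
    exact ⟨fun h => h.trans hc, fun h => h.trans hc.symm⟩
  simp only [MonoidAlgebra.of_apply, MonoidAlgebra.coeff_mul_single_apply,
    MonoidAlgebra.coeff_single_mul_apply, coeff_classSum, this, mul_one, one_mul]

lemma exists_classSum_mul_ne_zero {z e : MonoidAlgebra ℂ G} (hz : ∀ r, Commute z r)
    (hze : z * e ≠ 0) : ∃ x, z.coeff x ≠ 0 ∧ classSum x * e ≠ 0 := by
  by_contra! h
  apply hze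
  have hdec : z = ∑ g, (z.coeff g / (Finset.univ.filter fun y => IsConj y g).card) •
      classSum g := by
    ext g
    have hcard : ∀ y, IsConj y g → (Finset.univ.filter fun w => IsConj w y) =
        Finset.univ.filter fun w => IsConj w g := fun y hy => by
      ext w
      simp only [Finset.mem_filter, Finset.mem_univ, true_and]
      exact ⟨fun h => h.trans hy, fun h => h.trans hy.symm⟩
    have hpos : ((Finset.univ.filter fun w => IsConj w g).card : ℂ) ≠ 0 := by
      exact_mod_cast Finset.card_ne_zero.2 ⟨g, by simpa using IsConj.refl g⟩
    rw [MonoidAlgebra.coeff_sum, Finsupp.finsetSum_apply]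
    simp only [MonoidAlgebra.coeff_smul_apply, coeff_classSum, smul_eq_mul, mul_ite, mul_one,
      mul_zero]
    rw [← Finset.sum_filter, Finset.sum_congr rfl (g := fun _ => z.coeff g /
      (Finset.univ.filter fun w => IsConj w g).card) (fun y hy => by
        have hy' : IsConj y g := (Finset.mem_filter.1 hy).2
        rw [hcard y hy', MonoidAlgebra.coeff_eq_of_isConj hz hy'])]
    rw [Finset.sum_const, nsmul_eq_mul, mul_div_cancel₀ _ hpos]
  rw [hdec, Finset.sum_mul]
  refine Finset.sum_eq_zero fun g _ => ?_
  rw [smul_mul_assoc]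
  by_cases hg : z.coeff g = 0
  · simp [hg]
  · rw [h g hg, smul_zero]

end ClassSum

section CosetSupported

variable {G : Type*} [Group G] (H : Subgroup G)

/-- The elements of `ℂ[G]` supported on the coset `q` of `H`. -/
def cosetSupported (q : G ⧸ H) : Submodule ℂ (MonoidAlgebra ℂ G) where
  carrier := {r | ∀ g, r.coeff g ≠ 0 → (g : G ⧸ H) = q}
  add_mem' {a b} ha hb g hg := by
    by_cases h : a.coeff g = 0
    · exact hb g fun h' => hg (by simp [h, h'])
    · exact ha g h
  zero_mem' g hg := absurd rfl hg
  smul_mem' a r hr g hg := hr g fun h => hg (by simp [h])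

variable {H}

lemma of_mem_cosetSupported (g : G) :
    MonoidAlgebra.of ℂ G g ∈ cosetSupported H (g : G ⧸ H) := by
  intro h hh
  by_cases hgh : g = h
  · rw [hgh]
  · simp [hgh] at hh

lemma mul_mem_cosetSupported [H.Normal] {a b : G ⧸ H} {r s : MonoidAlgebra ℂ G}
    (hr : r ∈ cosetSupported H a) (hs : s ∈ cosetSupported H b) :
    r * s ∈ cosetSupported H (a * b) := by
  intro g hg
  have : g ∈ (r * s).coeff.support := Finsupp.mem_support_iff.2 hg
  obtain ⟨x, hx, y, hy, rfl⟩ := Finset.mem_mul.1 (MonoidAlgebra.support_coeff_mul_subset r s this)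
  rw [QuotientGroup.mk_mul, hr x (Finsupp.mem_support_iff.1 hx),
    hs y (Finsupp.mem_support_iff.1 hy)]

lemma pow_mem_cosetSupported [H.Normal] {a : G ⧸ H} {r : MonoidAlgebra ℂ G}
    (hr : r ∈ cosetSupported H a) (n : ℕ) : r ^ n ∈ cosetSupported H (a ^ n) := by
  induction n with
  | zero => simpa [MonoidAlgebra.one_def] using of_mem_cosetSupported (H := H) 1
  | succ n ih => simpa only [pow_succ] using mul_mem_cosetSupported ih hr

end CosetSupported

section Block

variable {K G W : Type*} [Group K] [Fintype K] [Group G] [AddCommGroup W] [Module ℂ W]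
  {φ : K →* G} {η : Representation ℂ K W}

lemma commute_endToGroupAlgebra {z : MonoidAlgebra ℂ G}
    (hz : ∀ k, Commute z (MonoidAlgebra.of ℂ G (φ k))) (M : Module.End ℂ W) :
    Commute z (endToGroupAlgebra φ η M) := by
  rw [endToGroupAlgebra_apply]
  exact Commute.sum_right _ _ _ fun k _ => (hz k).smul_right _

lemma IsIrreducibleRep.sum_conj_endToGroupAlgebra [FiniteDimensional ℂ W]
    (hη : IsIrreducibleRep η)
    (M : Module.End ℂ W) :
    ((Module.finrank ℂ W : ℂ) / Nat.card K) • ∑ k, MonoidAlgebra.of ℂ G (φ k) *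
        endToGroupAlgebra φ η M * MonoidAlgebra.of ℂ G (φ k⁻¹) =
      LinearMap.trace ℂ W M • pciMap φ η := by
  simp only [of_mul_endToGroupAlgebra, endToGroupAlgebra_mul_of, ← map_sum]
  rw [← map_smul, hη.sum_conj, map_smul, endToGroupAlgebra_one]

/-- Averaging over `K`: if `r` and `z` commute with `K` and, for every `g` in the support of `r`,
`g e_η` lies in `(ℂ[K] e_η) zⁿ` for some `n ∈ I`, then `r e_η` is in the span of the `e_η zⁿ`,
`n ∈ I`. -/
lemma IsIrreducibleRep.mul_pciMap_mem_span [FiniteDimensional ℂ W] (hη : IsIrreducibleRep η)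
    {z r : MonoidAlgebra ℂ G}
    (hz : ∀ k, Commute z (MonoidAlgebra.of ℂ G (φ k)))
    (hr : ∀ k, Commute r (MonoidAlgebra.of ℂ G (φ k)))
    (hc : ∀ s, Commute (pciMap φ η) s) (I : Set ℕ)
    (hI : ∀ g, r.coeff g ≠ 0 → ∃ M, ∃ n ∈ I,
      MonoidAlgebra.of ℂ G g * pciMap φ η = endToGroupAlgebra φ η M * z ^ n) :
    r * pciMap φ η ∈ Submodule.span ℂ ((fun n => pciMap φ η * z ^ n) '' I) := by
  have := hη.1
  set e := pciMap φ η
  set Q := Submodule.span ℂ ((fun n => e * z ^ n) '' I)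
  have hd : (Module.finrank ℂ W : ℂ) ≠ 0 := by exact_mod_cast Module.finrank_pos.ne'
  have hK : (Fintype.card K : ℂ) ≠ 0 := by exact_mod_cast Fintype.card_ne_zero
  obtain ⟨A, hA⟩ : ∃ A : MonoidAlgebra ℂ G →ₗ[ℂ] MonoidAlgebra ℂ G,
      ∀ s, A s = ((Module.finrank ℂ W : ℂ) / Nat.card K) •
        ∑ k, MonoidAlgebra.of ℂ G (φ k) * s * MonoidAlgebra.of ℂ G (φ k⁻¹) :=
    ⟨((Module.finrank ℂ W : ℂ) / Nat.card K) • ∑ k,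
      LinearMap.mulLeftRight ℂ (MonoidAlgebra.of ℂ G (φ k), MonoidAlgebra.of ℂ G (φ k⁻¹)),
      fun s => by simp [LinearMap.sum_apply]⟩
  have hAr : A (r * e) = (Module.finrank ℂ W : ℂ) • (r * e) := by
    have : ∀ k, MonoidAlgebra.of ℂ G (φ k) * (r * e) * MonoidAlgebra.of ℂ G (φ k⁻¹) =
        r * e := fun k => by
      rw [← mul_assoc, ← (hr k).eq, mul_assoc r, ← (hc _).eq, ← mul_assoc, mul_assoc,
        ← map_mul, ← map_mul, mul_inv_cancel, map_one, map_one, mul_one]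
    simp only [hA, this, Finset.sum_const, Finset.card_univ, ← Nat.cast_smul_eq_nsmul ℂ,
      smul_smul, Nat.card_eq_fintype_card]
    rw [div_mul_cancel₀ _ hK]
  have hAz : ∀ M n, A (endToGroupAlgebra φ η M * z ^ n) =
      LinearMap.trace ℂ W M • (e * z ^ n) := fun M n => by
    have hk : ∀ k, MonoidAlgebra.of ℂ G (φ k) * (endToGroupAlgebra φ η M * z ^ n) *
        MonoidAlgebra.of ℂ G (φ k⁻¹) = MonoidAlgebra.of ℂ G (φ k) *
        endToGroupAlgebra φ η M * MonoidAlgebra.of ℂ G (φ k⁻¹) * z ^ n := fun k => by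
      rw [← mul_assoc, mul_assoc _ (z ^ n), ((hz k⁻¹).pow_left n).eq, ← mul_assoc]
    simp only [hA, hk]
    rw [← Finset.sum_mul, ← smul_mul_assoc, hη.sum_conj_endToGroupAlgebra, smul_mul_assoc]
  rw [← Submodule.smul_mem_iff Q hd, ← hAr, ← MonoidAlgebra.sum_coeff_single r, Finsupp.sum,
    Finset.sum_mul, map_sum]
  refine sum_mem fun g hg => ?_
  obtain ⟨M, n, hn, hM⟩ := hI g (Finsupp.mem_support_iff.1 hg)
  rw [show MonoidAlgebra.single g (r.coeff g) = r.coeff g • MonoidAlgebra.of ℂ G g by simp,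
    smul_mul_assoc, map_smul, hM, hAz]
  exact Q.smul_mem _ (Q.smul_mem _ (Submodule.subset_span ⟨n, hn, rfl⟩))

end Block

/-- Let `G` be a finite group, `H ⊴ G` of prime index `p`, `η` an irreducible
complex representation of `H` with primitive central idempotent `e_η ∈ ℂ[H] ⊆ ℂ[G]`, and
suppose `e_η` is central in `ℂ[G]`.  Then there is an `x ∈ G ∖ H`, with `xH` generating
`G/H`, such that `C̄(x)^p e_η = λ e_η` for some `λ ≠ 0`.  Moreover, for any `p`-th root `μ`
of `λ`, setting `c = C̄(x) e_η / μ` and fixing a primitive `p`-th root of unity `ζ`, the `p`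
elements `f_i = (1/p)(∑_{k<p} ζ^{ik} c^k) e_η` (`i = 0, …, p-1`) are pairwise distinct and
are exactly the primitive central idempotents of `ℂ[G]` lying in the ideal `ℂ[G]e_η`,
i.e. the primitive central idempotents of the `p` extensions of `η` to `G`. -/
theorem stmt16 {G : Type*} [Group G] [Fintype G] (H : Subgroup G) [H.Normal]
    (p : ℕ) (hp : p.Prime) (hidx : H.index = p)
    {W : Type*} [AddCommGroup W] [Module ℂ W] [FiniteDimensional ℂ W]
    (η : Representation ℂ H W) (hη : IsIrreducibleRep η)
    (hcentral : pciMap H.subtype η ∈ Set.center (MonoidAlgebra ℂ G)) :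
    ∃ x : G, x ∉ H ∧ (∀ g : G ⧸ H, g ∈ Subgroup.zpowers (QuotientGroup.mk x : G ⧸ H)) ∧
      ∃ lam : ℂ, lam ≠ 0 ∧
        classSum x ^ p * pciMap H.subtype η = lam • pciMap H.subtype η ∧
        ∀ μ : ℂ, μ ^ p = lam → ∀ ζ : ℂ, IsPrimitiveRoot ζ p →
          ∀ c : MonoidAlgebra ℂ G, c = μ⁻¹ • (classSum x * pciMap H.subtype η) →
            ∀ f : Fin p → MonoidAlgebra ℂ G,
              (∀ i : Fin p, f i =
                (p : ℂ)⁻¹ •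
                  ((∑ k ∈ Finset.range p, ζ ^ ((i : ℕ) * k) • c ^ k) *
                    pciMap H.subtype η)) →
              Function.Injective f ∧
              ∀ E : MonoidAlgebra ℂ G,
                (IsPrimitiveCentralIdempotent E ∧ E * pciMap H.subtype η = E) ↔
                  ∃ i : Fin p, E = f i := by
  have : Fact p.Prime := ⟨hp⟩
  have hcard : Nat.card (G ⧸ H) = p := hidx
  set e := pciMap H.subtype η
  have hec : ∀ r, Commute e r := fun r => (Semigroup.mem_center_iff.1 hcentral r).symm
  obtain ⟨q, hq⟩ : ∃ q : G ⧸ H, q ≠ 1 := by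
    have : Nontrivial (G ⧸ H) := Finite.one_lt_card_iff_nontrivial.1 (hcard ▸ hp.one_lt)
    exact exists_ne 1
  have hqp : q ^ p = 1 := by rw [← hcard]; exact pow_card_eq_one'
  have hqord : orderOf q = p := orderOf_eq_prime hqp hq
  have hgen : ∀ g : G ⧸ H, g ∈ Subgroup.zpowers q := fun g => mem_zpowers_of_prime_card hcard hq
  have hgen' : ∀ g : G ⧸ H, ∃ n : ℕ, q ^ n = g := fun g => mem_powers_of_prime_card hcard hq
  obtain ⟨t, rfl⟩ := QuotientGroup.mk_surjective q
  set q : G ⧸ H := (t : G ⧸ H)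
  have hφ : Function.Injective H.subtype := H.subtype_injective
  set S := endToGroupAlgebra H.subtype η
  set T := MonoidAlgebra.of ℂ G t
  have hmul : ∀ M N, S (M * N) = S M * S N := hη.endToGroupAlgebra_mul H.subtype
  have hS1 : S 1 = e := endToGroupAlgebra_one H.subtype η
  have he : IsIdempotentElem e := by rw [IsIdempotentElem, ← hS1, ← hmul, one_mul]
  have he1 : e.coeff 1 ≠ 0 := by
    have := hη.1
    have h := coeff_endToGroupAlgebra hφ η 1 1
    rw [endToGroupAlgebra_one, map_one H.subtype] at h
    rw [h]
    have hd : (Module.finrank ℂ W : ℂ) ≠ 0 := by exact_mod_cast Module.finrank_pos.ne'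
    have hK : (Nat.card H : ℂ) ≠ 0 := by exact_mod_cast Nat.card_pos.ne'
    simp [hd]
  have he0 : e ≠ 0 := fun h => he1 (by simp [h])
  have hSmem : ∀ M, S M ∈ cosetSupported H 1 := fun M => by
    rw [show S M = _ from endToGroupAlgebra_apply H.subtype η M]
    refine sum_mem fun k _ => Submodule.smul_mem _ _ ?_
    exact (QuotientGroup.eq_one_iff (H.subtype k)).2 k.2 ▸
      of_mem_cosetSupported (H := H) (H.subtype k)
  have hemem : e ∈ cosetSupported H 1 := hS1 ▸ hSmem 1
  obtain ⟨u, hu⟩ := hη.exists_conj_endToGroupAlgebra hφ hec t (MulAut.conjNormal t)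
    (fun k => by simp)
  change ∀ M, T * S M = S (u * M * ↑u⁻¹) * T at hu
  -- the central element spanning the centre of the block
  obtain ⟨z, hzdef⟩ : ∃ z, z = S ↑u⁻¹ * T := ⟨_, rfl⟩
  have hzH : ∀ k, Commute z (MonoidAlgebra.of ℂ G (H.subtype k)) := by
    intro k
    have hTk : T * S (η k) = T * MonoidAlgebra.of ℂ G (H.subtype k) * e := by
      rw [mul_assoc, ← hS1, of_mul_endToGroupAlgebra, mul_one]
    have hk : S ↑u⁻¹ = S ↑u⁻¹ * e := by rw [← hS1, ← hmul, mul_one]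
    have h1 : z * MonoidAlgebra.of ℂ G (H.subtype k) = S ↑u⁻¹ * (T * S (η k)) := by
      rw [hTk, ← (hec _).eq, ← mul_assoc, ← hk, hzdef, mul_assoc]
    have h2 : MonoidAlgebra.of ℂ G (H.subtype k) * z = S (η k * ↑u⁻¹) * T := by
      rw [hzdef, ← mul_assoc, of_mul_endToGroupAlgebra]
    rw [Commute, SemiconjBy, h1, hu, ← mul_assoc, ← hmul, h2]
    simp [← mul_assoc]
  have hzT : Commute z T := by
    rw [Commute, SemiconjBy, hzdef, ← mul_assoc, hu]
    simp
  have hTe : T * e = S u * z := by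
    rw [hzdef, ← mul_assoc, ← hmul, Units.mul_inv, hS1, (hec T).eq]
  have hTn : ∀ n, T ^ n * e = S (↑u ^ n) * z ^ n := by
    intro n
    induction n with
    | zero => simp [hS1]
    | succ n ih =>
      have hcomm := (commute_endToGroupAlgebra (η := η) hzH (u : Module.End ℂ W)).pow_left n
      have heu : e * S u = S u := by rw [← hS1, ← hmul, one_mul]
      calc T ^ (n + 1) * e = T ^ n * e * S u * z := by
            rw [pow_succ, mul_assoc, hTe, mul_assoc _ e, heu, mul_assoc]
        _ = S (↑u ^ n) * (z ^ n * S u) * z := by rw [ih, mul_assoc _ (z ^ n)]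
        _ = S (↑u ^ (n + 1)) * z ^ (n + 1) := by
            rw [hcomm.eq, pow_succ, hmul, pow_succ]
            simp only [mul_assoc]
            rfl
  have hdecomp : ∀ (g : G) (n : ℕ), (g : G ⧸ H) = q ^ n → ∃ k : H,
      MonoidAlgebra.of ℂ G g = MonoidAlgebra.of ℂ G (H.subtype k) * T ^ n := by
    intro g n hg
    refine ⟨⟨g * (t ^ n)⁻¹, ?_⟩, ?_⟩
    · rw [← QuotientGroup.eq_one_iff, QuotientGroup.mk_mul, hg, QuotientGroup.mk_inv,
        QuotientGroup.mk_pow, mul_inv_cancel]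
    · rw [← map_pow, ← map_mul]
      simp
  have hge : ∀ (g : G) (n : ℕ), (g : G ⧸ H) = q ^ n →
      ∃ M, MonoidAlgebra.of ℂ G g * e = S M * z ^ n := by
    intro g n hg
    obtain ⟨k, hk⟩ := hdecomp g n hg
    exact ⟨_, by rw [hk, mul_assoc, hTn, ← mul_assoc, of_mul_endToGroupAlgebra]⟩
  have hzc : ∀ r, Commute z r := MonoidAlgebra.commute_of_forall_of fun g => by
    obtain ⟨n, hn⟩ := hgen' g
    obtain ⟨k, hk⟩ := hdecomp g n hn.symm
    rw [hk]
    exact (hzH k).mul_right (hzT.pow_right n)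
  have hzmem : z ∈ cosetSupported H q := by
    have := mul_mem_cosetSupported (hSmem ↑u⁻¹) (of_mem_cosetSupported (H := H) t)
    rwa [one_mul, ← hzdef] at this
  have hze : z * e = z := by
    rw [← (hec z).eq, hzdef, ← mul_assoc, ← hS1, ← hmul, one_mul]
  have hTn0 : ∀ n, T ^ n * e ≠ 0 := by
    intro n h
    apply he0
    have : MonoidAlgebra.of ℂ G (t ^ n)⁻¹ * (T ^ n * e) = e := by
      rw [← mul_assoc, ← map_pow, ← map_mul, inv_mul_cancel, map_one, one_mul]
    rw [← this, h, mul_zero]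
  obtain ⟨x, hx, hxe⟩ := exists_classSum_mul_ne_zero hzc (e := e) (fun h => by
    rw [hze] at h
    apply hTn0 1
    rw [pow_one, hTe, h, mul_zero])
  have hxq : (x : G ⧸ H) = q := hzmem x hx
  -- `z ^ p` is a scalar in the block
  obtain ⟨b, hb⟩ : ∃ b : ℂ, b • e = z ^ p := by
    have h := hη.mul_pciMap_mem_span hzH (fun k => (hzc _).pow_left p) hec {0} (fun g hg => by
      have hg' := pow_mem_cosetSupported hzmem p g hg
      rw [hqp] at hg'
      obtain ⟨M, hM⟩ := hge g 0 (by simpa using hg')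
      exact ⟨M, 0, rfl, hM⟩)
    rw [Set.image_singleton, Submodule.mem_span_singleton, pow_zero, mul_one] at h
    obtain ⟨b, hb⟩ := h
    refine ⟨b, hb.trans ?_⟩
    conv_rhs => rw [← hze, (hzc e).mul_pow, he.pow_eq hp.ne_zero]
  have hb0 : b ≠ 0 := by
    rintro rfl
    apply hTn0 p
    rw [hTn, ← hb, zero_smul, mul_zero]
  obtain ⟨a, ha⟩ : ∃ a : ℂ, a • z = classSum x * e := by
    have h := hη.mul_pciMap_mem_span (r := classSum x) hzH (fun k => classSum_commute _ _) hec {1}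
      (fun g hg => by
        have hxg : IsConj x g := by
          by_contra h
          exact hg (by rw [coeff_classSum, if_neg h])
        obtain ⟨y, rfl⟩ := isConj_iff.1 hxg
        obtain ⟨n, hn⟩ := hgen' y
        obtain ⟨M, hM⟩ := hge (y * x * y⁻¹) 1 (by
          rw [QuotientGroup.mk_mul, QuotientGroup.mk_mul, QuotientGroup.mk_inv, hxq, ← hn]
          group)
        exact ⟨M, 1, rfl, hM⟩)
    rw [Set.image_singleton, Submodule.mem_span_singleton, pow_one, (hec z).eq, hze] at h
    exact h
  have ha0 : a ≠ 0 := by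
    rintro rfl
    exact hxe (by rw [← ha, zero_smul])
  have hCp : classSum x ^ p * e = (a ^ p * b) • e := by
    rw [mul_smul, hb, ← smul_pow, ha, (classSum_commute x e).mul_pow, he.pow_eq hp.ne_zero]
  refine ⟨x, fun hxH => hq ?_, fun g => ?_, a ^ p * b, mul_ne_zero (pow_ne_zero _ ha0) hb0, hCp,
    ?_⟩
  · rw [← hxq]
    exact (QuotientGroup.eq_one_iff _).2 hxH
  · rw [hxq]
    exact hgen g
  intro μ hμ ζ hζ c hc f hf
  have hμ0 : μ ≠ 0 := by
    rintro rfl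
    rw [zero_pow hp.ne_zero] at hμ
    exact mul_ne_zero (pow_ne_zero _ ha0) hb0 hμ.symm
  rw [← ha, smul_smul] at hc
  have hp0 : (p : ℂ) ≠ 0 := by exact_mod_cast hp.ne_zero
  have hcmem : c ∈ cosetSupported H q := hc ▸ Submodule.smul_mem _ _ hzmem
  refine isPrimitiveCentralIdempotent_iff_fourier hp0 hζ he hec
    (fun r => hc ▸ (hzc r).smul_left _) ?_ hf (fun i hi => ?_)
    (fun E hE hEe => ?_)
  · rw [hc, smul_pow, ← hb, smul_smul, mul_pow, inv_pow, hμ, mul_assoc,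
      inv_mul_cancel₀ (mul_ne_zero (pow_ne_zero _ ha0) hb0), one_smul]
  · apply he1
    rw [hf, smul_eq_zero, or_iff_right (inv_ne_zero hp0), Finset.sum_mul] at hi
    have hi1 := congrArg (fun r : MonoidAlgebra ℂ G => r.coeff 1) hi
    simp only [MonoidAlgebra.coeff_sum, Finsupp.finsetSum_apply] at hi1
    rw [Finset.sum_eq_single 0 (fun n hn hn0 => ?_)
      (fun h => absurd (Finset.mem_range.2 hp.pos) h)] at hi1
    · simpa using hi1
    · by_contra h
      have hmem := mul_mem_cosetSupported (Submodule.smul_mem _ (ζ ^ ((i : ℕ) * n))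
        (pow_mem_cosetSupported hcmem n)) hemem 1 h
      rw [mul_one] at hmem
      have := orderOf_dvd_of_pow_eq_one hmem.symm
      rw [hqord] at this
      exact absurd (Nat.le_of_dvd (Nat.pos_of_ne_zero hn0) this)
        (not_le.2 (Finset.mem_range.1 hn))
  · have h := hη.mul_pciMap_mem_span (r := E) hzH
      (fun k => (Semigroup.mem_center_iff.1 hE _).symm) hec Set.univ (fun g _ => by
        obtain ⟨n, hn⟩ := hgen' g
        obtain ⟨M, hM⟩ := hge g n hn.symm
        exact ⟨M, n, trivial, hM⟩)
    change E * e ∈ _ at h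
    rw [hEe] at h
    refine Submodule.span_le.2 ?_ h
    rintro _ ⟨n, -, rfl⟩
    have hcn : e * z ^ n = ((μ⁻¹ * a) ^ n)⁻¹ • (c ^ n * e) := by
      rw [hc, smul_pow, smul_mul_assoc, smul_smul, inv_mul_cancel₀, one_smul, (hec _).eq]
      exact pow_ne_zero _ (mul_ne_zero (inv_ne_zero hμ0) ha0)
    change e * z ^ n ∈ _
    rw [hcn]
    exact Submodule.smul_mem _ _ (Submodule.subset_span ⟨n, rfl⟩)
end
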